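/- For a generic endomorphism f of ℂⁿ (n ≥ 1): (a) for every compact subset K of ℂⁿ, f has an attracting fixed point outside K and a repelling fixed point outside K, and if n ≥ 2 also a saddle fixed point outside K; (b) the Julia set J_f is not compact; (c) J_f is perfect, i.e., it has no isolated points. (Proposition 2.14 of the paper, proved for Oka-Stein manifolds; specialized to ℂⁿ.) -/

import Mathlib

open Function Topology Filter Metric

noncomputable section

/-- `ℂⁿ` as a Euclidean space. -/
abbrev Cn (n : ℕ) := EuclideanSpace ℂ (Fin n)

/-- The space `End(ℂⁿ)` of holomorphic self-maps of `ℂⁿ`, topologized as a subspace of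
the continuous maps `C(ℂⁿ, ℂⁿ)` with the compact-open topology. -/
abbrev Endo (n : ℕ) := {f : C(Cn n, Cn n) // Differentiable ℂ ⇑f}

variable {n : ℕ}

/-- The underlying function of an endomorphism. -/
def eapp (f : Endo n) : Cn n → Cn n := ⇑f.1

/-- `p` is a periodic point of `f`. -/
def IsPer (f : Endo n) (p : Cn n) : Prop := ∃ m, 1 ≤ m ∧ (eapp f)^[m] p = p

/-- The minimal period of a periodic point. -/
def minPer (f : Endo n) (p : Cn n) : ℕ := Function.minimalPeriod (eapp f) p

/-- The eigenvalues at a periodic point `p`: the spectrum of the derivative of the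
`minPer f p`-th iterate at `p`. -/
def eigs (f : Endo n) (p : Cn n) : Set ℂ := spectrum ℂ (fderiv ℂ ((eapp f)^[minPer f p]) p)

/-- Hyperbolic periodic point: no eigenvalue of absolute value 1. -/
def IsHypPer (f : Endo n) (p : Cn n) : Prop := IsPer f p ∧ ∀ z ∈ eigs f p, ‖z‖ ≠ 1

/-- Attracting periodic point: all eigenvalues of absolute value < 1. -/
def IsAttPer (f : Endo n) (p : Cn n) : Prop := IsPer f p ∧ ∀ z ∈ eigs f p, ‖z‖ < 1

/-- Repelling periodic point: all eigenvalues of absolute value > 1. -/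
def IsRepPer (f : Endo n) (p : Cn n) : Prop := IsPer f p ∧ ∀ z ∈ eigs f p, 1 < ‖z‖

/-- Saddle periodic point: hyperbolic with eigenvalues of absolute value both < 1 and > 1. -/
def IsSadPer (f : Endo n) (p : Cn n) : Prop :=
  IsHypPer f p ∧ (∃ z ∈ eigs f p, ‖z‖ < 1) ∧ (∃ z ∈ eigs f p, 1 < ‖z‖)

/-- Super-attracting periodic point: the derivative of the `minPer`-th iterate vanishes. -/
def IsSuperAttPer (f : Endo n) (p : Cn n) : Prop :=
  IsPer f p ∧ fderiv ℂ ((eapp f)^[minPer f p]) p = 0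

/-- The set of attracting periodic points of `f`. -/
def attSet (f : Endo n) : Set (Cn n) := {p | IsAttPer f p}

/-- The set of repelling periodic points of `f`. -/
def repSet (f : Endo n) : Set (Cn n) := {p | IsRepPer f p}

/-- The set of saddle periodic points of `f`. -/
def sadSet (f : Endo n) : Set (Cn n) := {p | IsSadPer f p}

/-- The robustly non-expelling set of `f`. -/
def rne (f : Endo n) : Set (Cn n) :=
  {p | ∃ U : Set (Cn n), IsOpen U ∧ p ∈ U ∧ ∃ V ∈ 𝓝 f, ∃ K : Set (Cn n),
        IsCompact K ∧ ∀ g ∈ V, ∀ j : ℕ, (eapp g)^[j] '' U ⊆ K}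

/-- A sequence of maps diverges locally uniformly to infinity on `U`. -/
def DivLocUnifOn (F : ℕ → Cn n → Cn n) (U : Set (Cn n)) : Prop :=
  ∀ L ⊆ U, IsCompact L → ∀ K : Set (Cn n), IsCompact K →
    ∀ᶠ j in atTop, Disjoint (F j '' L) K

/-- `p` belongs to the Fatou set of `f`: the iterates form a normal family near `p`. -/
def FatouAt (f : Endo n) (p : Cn n) : Prop :=
  ∃ U : Set (Cn n), IsOpen U ∧ p ∈ U ∧
    ∀ k : ℕ → ℕ, StrictMono k → ∃ l : ℕ → ℕ, StrictMono l ∧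
      ((∃ g : Cn n → Cn n, DifferentiableOn ℂ g U ∧
          TendstoLocallyUniformlyOn (fun j => (eapp f)^[k (l j)]) g atTop U) ∨
        DivLocUnifOn (fun j => (eapp f)^[k (l j)]) U)

/-- The Fatou set of `f`. -/
def Fatou (f : Endo n) : Set (Cn n) := {p | FatouAt f p}

/-- The Julia set of `f`. -/
def Julia (f : Endo n) : Set (Cn n) := (Fatou f)ᶜ

/-- The cycle (finite orbit) of a periodic point `p`. -/
def cycleOf (f : Endo n) (p : Cn n) : Set (Cn n) := {x | ∃ i < minPer f p, (eapp f)^[i] p = x}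

/-- The basin of attraction of the cycle of `p`. -/
def basinOf (f : Endo n) (p : Cn n) : Set (Cn n) :=
  {x | ∃ a ∈ cycleOf f p, Tendsto (fun k => (eapp f)^[minPer f p * k] x) atTop (𝓝 a)}

/-- The non-wandering set of `f`. -/
def nonWandering (f : Endo n) : Set (Cn n) :=
  {p | ∀ U ∈ 𝓝 p, ∃ k, 1 ≤ k ∧ (U ∩ (eapp f)^[k] '' U).Nonempty}

/-- The set of points whose orbit can be closed in the weak sense. -/
def cloSet (f : Endo n) : Set (Cn n) :=
  {p | ∀ U ∈ 𝓝 p, ∀ V ∈ 𝓝 f, ∃ g ∈ V, ∃ q ∈ U, IsPer g q}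

/-- `𝒯(m,K)`: endomorphisms all of whose periodic points in `K` of minimal period at most `m`
are transverse. -/
def TransSet (n : ℕ) (m : ℕ) (K : Set (Cn n)) : Set (Endo n) :=
  {f | ∀ p ∈ K, IsPer f p → minPer f p ≤ m → (1 : ℂ) ∉ eigs f p}

/-- `ℋ(m,K)`: endomorphisms all of whose periodic points in `K` of minimal period at most `m`
are hyperbolic. -/
def HypSet (n : ℕ) (m : ℕ) (K : Set (Cn n)) : Set (Endo n) :=
  {f | ∀ p ∈ K, IsPer f p → minPer f p ≤ m → ∀ z ∈ eigs f p, ‖z‖ ≠ 1}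

/-- The `m`-th iterate of an endomorphism as an endomorphism. -/
def iterEndo (f : Endo n) (m : ℕ) : Endo n :=
  ⟨⟨(eapp f)^[m], f.1.continuous.iterate m⟩, f.2.iterate m⟩

/-- The set of points with relatively compact forward orbit. -/
def boundedOrb (f : Endo n) : Set (Cn n) :=
  {p | ∃ K : Set (Cn n), IsCompact K ∧ ∀ k : ℕ, (eapp f)^[k] p ∈ K}

/-- An `ε`-chain (pseudo-orbit) of `f` from `x` to `y`. -/
def EpsChain (f : Endo n) (ε : Cn n → ℝ) (x y : Cn n) : Prop :=
  ∃ N : ℕ, 1 ≤ N ∧ ∃ c : ℕ → Cn n, c 0 = x ∧ c N = y ∧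
    ∀ j < N, dist (eapp f (c j)) (c (j + 1)) < ε (eapp f (c j))

/-- `x` and `y` are chain-equivalent for `f`. -/
def ChainEquiv (f : Endo n) (x y : Cn n) : Prop :=
  ∀ ε : Cn n → ℝ, Continuous ε → (∀ z, 0 < ε z) → EpsChain f ε x y ∧ EpsChain f ε y x

/-- `x` is chain-recurrent for `f`. -/
def ChainRec (f : Endo n) (x : Cn n) : Prop :=
  ∀ ε : Cn n → ℝ, Continuous ε → (∀ z, 0 < ε z) → EpsChain f ε x x

/-- Attracting fixed point. -/
def IsAttFix (f : Endo n) (p : Cn n) : Prop :=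
  eapp f p = p ∧ ∀ z ∈ spectrum ℂ (fderiv ℂ (eapp f) p), ‖z‖ < 1

/-- Repelling fixed point. -/
def IsRepFix (f : Endo n) (p : Cn n) : Prop :=
  eapp f p = p ∧ ∀ z ∈ spectrum ℂ (fderiv ℂ (eapp f) p), 1 < ‖z‖

/-- Saddle fixed point. -/
def IsSadFix (f : Endo n) (p : Cn n) : Prop :=
  eapp f p = p ∧ (∀ z ∈ spectrum ℂ (fderiv ℂ (eapp f) p), ‖z‖ ≠ 1) ∧
    (∃ z ∈ spectrum ℂ (fderiv ℂ (eapp f) p), ‖z‖ < 1) ∧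
    (∃ z ∈ spectrum ℂ (fderiv ℂ (eapp f) p), 1 < ‖z‖)

/-- `f` is a local biholomorphism at `p`: `f` agrees near `p` with a homeomorphism onto an
open set whose inverse is holomorphic. -/
def LocalBiholoAt (f : Endo n) (p : Cn n) : Prop :=
  ∃ φ : PartialHomeomorph (Cn n) (Cn n), p ∈ φ.source ∧ Set.EqOn (eapp f) φ φ.source ∧
    DifferentiableOn ℂ φ.symm φ.target


theorem aux_cauchy {f : Cn n → Cn n} {c : Cn n} {r C : ℝ} (hr : 0 < r)
    (hf : DifferentiableOn ℂ f (ball c r)) (hC : ∀ x ∈ ball c r, ‖f x‖ ≤ C) :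
    ‖fderiv ℂ f c‖ ≤ 2 * C / r := by
  refine Complex.norm_fderiv_le_div_of_mapsTo_ball hf (fun x hx => ?_) hr
  rw [mem_closedBall, dist_eq_norm]
  calc _ ≤ ‖f x‖ + ‖f c‖ := norm_sub_le _ _
    _ ≤ 2 * C := by linarith [hC x hx, hC c (mem_ball_self hr)]

theorem aux_nhds (f : Endo n) {K : Set (Cn n)} (hK : IsCompact K) {ε : ℝ} (hε : 0 < ε) :
    ∀ᶠ h in 𝓝 f, ∀ x ∈ K, ‖eapp h x - eapp f x‖ < ε := by
  have h1 : Tendsto (fun h : Endo n => h.1) (𝓝 f) (𝓝 f.1) := continuous_subtype_val.continuousAt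
  rw [ContinuousMap.tendsto_iff_forall_isCompact_tendstoUniformlyOn] at h1
  have h2 := Metric.tendstoUniformlyOn_iff.1 (h1 K hK) ε hε
  filter_upwards [h2] with h hh x hx
  have := hh x hx
  rw [dist_comm, dist_eq_norm] at this
  exact this

theorem aux_mem_nhds {f : Endo n} {V : Set (Endo n)} (hV : V ∈ 𝓝 f) (R₀ : ℝ) :
    ∃ R > R₀, ∃ ε > 0, ∀ g : Endo n, (∀ x ∈ closedBall (0 : Cn n) R, ‖eapp g x - eapp f x‖ ≤ ε) →
      g ∈ V := by
  rw [nhds_subtype_eq_comap, mem_comap] at hV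
  obtain ⟨W, hW, hWV⟩ := hV
  have hb := nhds_basis_uniformity' (ContinuousMap.hasBasis_compactConvergenceUniformity (α := Cn n) (β := Cn n)) (x := f.1)
  obtain ⟨⟨K, E⟩, ⟨hK, hE⟩, hKE⟩ := hb.mem_iff.1 hW
  obtain ⟨ε, hε, hεE⟩ := Metric.mem_uniformity_dist.1 hE
  obtain ⟨R, hR⟩ := hK.isBounded.subset_closedBall 0
  refine ⟨max R (R₀ + 1), by simp, ε / 2, by positivity, fun g hg => hWV (hKE ?_)⟩
  intro x hx
  apply hεE
  have := hg x (closedBall_subset_closedBall (le_max_left _ _) (hR hx))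
  rw [dist_comm, dist_eq_norm]
  exact lt_of_le_of_lt this (by linarith)

theorem eapp_diff (f : Endo n) : Differentiable ℂ (eapp f) := f.2
theorem eapp_cont (f : Endo n) : Continuous (eapp f) := f.1.continuous
theorem iter_diff (f : Endo n) (k : ℕ) : Differentiable ℂ ((eapp f)^[k]) := f.2.iterate k
theorem iter_cont (f : Endo n) (k : ℕ) : Continuous ((eapp f)^[k]) := (eapp_cont f).iterate k

theorem aux_fderiv_cont (f : Endo n) (a : Cn n) {ε : ℝ} (hε : 0 < ε) :
    ∃ r₀ > 0, ∀ x ∈ closedBall a r₀, ‖fderiv ℂ (eapp f) x - fderiv ℂ (eapp f) a‖ ≤ ε := by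
  have hK : IsCompact (closedBall a 2) := isCompact_closedBall _ _
  have huc := hK.uniformContinuousOn_of_continuous (eapp_cont f).continuousOn
  rw [Metric.uniformContinuousOn_iff] at huc
  obtain ⟨δ, hδ, h⟩ := huc (ε / 2) (by positivity)
  refine ⟨min (δ / 2) 1, by positivity, fun x hx => ?_⟩
  rw [mem_closedBall] at hx
  have hx1 : dist x a < δ := by have := min_le_left (δ/2) 1; linarith
  have hx2 : dist x a ≤ 1 := hx.trans (min_le_right _ _)
  have hd := eapp_diff f
  have key : ‖fderiv ℂ (fun z => eapp f (z + (x - a)) - eapp f z) a‖ ≤ 2 * (ε / 2) / 1 := by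
    apply aux_cauchy one_pos
    · apply Differentiable.differentiableOn
      exact (hd.comp (differentiable_id.add_const _)).sub hd
    · intro z hz
      rw [mem_ball] at hz
      rw [← dist_eq_norm]
      apply le_of_lt
      have hh : dist (z + (x - a)) z = dist x a := by simp [dist_eq_norm]
      apply h
      · rw [mem_closedBall]
        have := dist_triangle (z + (x - a)) z a
        linarith
      · rw [mem_closedBall]; linarith
      · rwa [hh]
  have e : fderiv ℂ (fun z => eapp f (z + (x - a)) - eapp f z) a
      = fderiv ℂ (eapp f) x - fderiv ℂ (eapp f) a := by
    rw [fderiv_fun_sub, fderiv_comp_add_right]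
    · simp
    · exact (hd.comp (differentiable_id.add_const _)) _
    · exact hd _
  rw [e] at key
  linarith

theorem aux_persist (f : Endo n) (a : Cn n) {ε : ℝ} (hε : 0 < ε) :
    ∃ r > 0, r < ε ∧ ∀ᶠ h in 𝓝 f, ‖eapp h a - eapp f a‖ ≤ ε * r ∧
      ∀ x ∈ closedBall a r, ‖fderiv ℂ (eapp h) x - fderiv ℂ (eapp f) a‖ ≤ ε := by
  obtain ⟨r₀, hr₀, h0⟩ := aux_fderiv_cont f a (half_pos hε)
  refine ⟨min r₀ (ε / 2), by positivity, by have := min_le_right r₀ (ε/2); linarith, ?_⟩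
  set r := min r₀ (ε / 2) with hr
  have hrp : 0 < r := by positivity
  filter_upwards [aux_nhds f (isCompact_closedBall a (r + 1)) (show 0 < ε * r by positivity),
    aux_nhds f (isCompact_closedBall a (r + 1)) (show 0 < ε / 4 by positivity)] with h h1 h2
  refine ⟨(h1 a (mem_closedBall_self (by linarith))).le, fun x hx => ?_⟩
  have key : ‖fderiv ℂ (fun z => eapp h z - eapp f z) x‖ ≤ 2 * (ε / 4) / 1 := by
    apply aux_cauchy one_pos
    · exact ((eapp_diff h).sub (eapp_diff f)).differentiableOn
    · intro z hz
      apply (h2 z _).le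
      rw [mem_closedBall] at *
      rw [mem_ball] at hz
      linarith [dist_triangle z x a]
  rw [fderiv_fun_sub (eapp_diff h x) (eapp_diff f x)] at key
  have h3 := h0 x (closedBall_subset_closedBall (min_le_left _ _) hx)
  calc _ = ‖(fderiv ℂ (eapp h) x - fderiv ℂ (eapp f) x) + (fderiv ℂ (eapp f) x - fderiv ℂ (eapp f) a)‖ := by
        rw [sub_add_sub_cancel]
    _ ≤ _ := norm_add_le _ _
    _ ≤ ε := by linarith

theorem aux_bump (S : Finset (Cn n)) (a : Cn n) (ha : a ∉ S) {R : ℝ} (hR : 0 ≤ R) (hRa : R < ‖a‖)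
    {η : ℝ} (hη : 0 < η) :
    ∃ H : Cn n → ℂ, Differentiable ℂ H ∧ H a = 1 ∧ fderiv ℂ H a = 0 ∧
      (∀ s ∈ S, H s = 0 ∧ fderiv ℂ H s = 0) ∧ ∀ x ∈ closedBall (0 : Cn n) R, ‖H x‖ ≤ η := by
  have ha0 : 0 < ‖a‖ := lt_of_le_of_lt hR hRa
  have ha0' : (‖a‖ : ℂ) ≠ 0 := by exact_mod_cast ha0.ne'
  let ℓ : Cn n → ℂ := fun z => innerSL ℂ a z / (‖a‖ : ℂ) ^ 2
  let P : Cn n → ℂ := fun z => ∏ s ∈ S, (innerSL ℂ (a - s) (z - s) / (‖a - s‖ : ℂ) ^ 2)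
  have hℓd : Differentiable ℂ ℓ := by
    have h1 : Differentiable ℂ (fun z => innerSL ℂ a z) := (innerSL ℂ a).differentiable
    simpa only [ℓ, div_eq_mul_inv] using h1.mul_const _
  have hPd : Differentiable ℂ P := by
    intro z
    have h1 : ∀ s ∈ S, DifferentiableAt ℂ
        (fun z => innerSL ℂ (a - s) (z - s) / (‖a - s‖ : ℂ) ^ 2) z := by
      intro s hs
      have h1 : Differentiable ℂ (fun z => innerSL ℂ (a - s) (z - s)) :=
        (innerSL ℂ (a - s)).differentiable.comp (differentiable_id.sub_const s)
      simpa only [div_eq_mul_inv] using (h1.mul_const _) z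
    classical
    exact (HasFDerivAt.finsetProd (fun s hs => (h1 s hs).hasFDerivAt)).differentiableAt
  have hℓa : ℓ a = 1 := by
    simp only [ℓ, innerSL_apply_apply, inner_self_eq_norm_sq_to_K]
    exact div_self (pow_ne_zero _ ha0')
  have hPa : P a = 1 := by
    apply Finset.prod_eq_one
    intro s hs
    have : (‖a - s‖ : ℂ) ≠ 0 := by
      have : a - s ≠ 0 := sub_ne_zero.2 (fun h => ha (h ▸ hs))
      exact_mod_cast (norm_pos_iff.2 this).ne'
    simp only [innerSL_apply_apply, inner_self_eq_norm_sq_to_K]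
    exact div_self (pow_ne_zero _ this)
  have hPs : ∀ s ∈ S, P s = 0 := fun s hs => Finset.prod_eq_zero hs (by simp)
  obtain ⟨C, hC⟩ := (isCompact_closedBall (0 : Cn n) R).exists_bound_of_continuousOn hPd.continuous.continuousOn
  have hq : R / ‖a‖ < 1 := (div_lt_one ha0).2 hRa
  have hq0 : 0 ≤ R / ‖a‖ := by positivity
  have hℓb : ∀ x ∈ closedBall (0 : Cn n) R, ‖ℓ x‖ ≤ R / ‖a‖ := by
    intro x hx
    rw [mem_closedBall, dist_zero_right] at hx
    simp only [ℓ, innerSL_apply_apply, norm_div, norm_pow, Complex.norm_real, norm_norm]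
    rw [div_le_div_iff₀ (by positivity) ha0]
    have := norm_inner_le_norm (𝕜 := ℂ) a x
    have h2 : ‖a‖ * ‖x‖ ≤ ‖a‖ * R := by gcongr
    nlinarith
  set δ : ℝ := min 1 (η / 3) with hδ
  have hδ0 : 0 < δ := by positivity
  have hδ1 : δ ≤ 1 := min_le_left _ _
  have hδη : δ ≤ η / 3 := min_le_right _ _
  have ht : Tendsto (fun m : ℕ => (R / ‖a‖) ^ m * |C|) atTop (𝓝 (0 * |C|)) :=
    (tendsto_pow_atTop_nhds_zero_of_lt_one hq0 hq).mul_const _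
  rw [zero_mul] at ht
  obtain ⟨m, hm⟩ := (ht.eventually (gt_mem_nhds hδ0)).exists
  let u : Cn n → ℂ := fun z => ℓ z ^ m * P z
  have hud : Differentiable ℂ u := (hℓd.pow m).mul hPd
  have hv : ∀ z, HasFDerivAt (fun z => u z ^ 2) ((2 * u z) • fderiv ℂ u z) z := by
    intro z
    have := (hud z).hasFDerivAt.pow 2
    refine this.congr_fderiv ?_
    ext; simp
  have hH : ∀ z, HasFDerivAt (fun z => 1 - (1 - u z ^ 2) ^ 2)
      ((2 * (1 - u z ^ 2)) • ((2 * u z) • fderiv ℂ u z)) z := by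
    intro z
    have := (((hv z).const_sub 1).pow 2).const_sub 1
    refine this.congr_fderiv ?_
    ext; simp
  refine ⟨fun z => 1 - (1 - u z ^ 2) ^ 2, fun z => (hH z).differentiableAt, ?_, ?_, ?_, ?_⟩
  · simp [u, hℓa, hPa]
  · have e : u a = 1 := by simp [u, hℓa, hPa]
    rw [(hH a).fderiv, e, one_pow, sub_self, mul_zero]
    ext v; simp
  · intro s hs
    have e : u s = 0 := by simp [u, hPs s hs]
    refine ⟨by simp [e], ?_⟩
    rw [(hH s).fderiv, e, mul_zero]
    ext v; simp
  · intro x hx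
    have hu : ‖u x‖ ≤ δ := by
      simp only [u, norm_mul, norm_pow]
      calc _ ≤ (R / ‖a‖) ^ m * |C| := by
            gcongr
            · exact hℓb x hx
            · exact (hC x hx).trans (le_abs_self _)
        _ ≤ δ := hm.le
    have e : 1 - (1 - u x ^ 2) ^ 2 = u x ^ 2 * (2 - u x ^ 2) := by ring
    change ‖1 - (1 - u x ^ 2) ^ 2‖ ≤ η
    rw [e, norm_mul, norm_pow]
    have h1 : ‖u x‖ ^ 2 ≤ δ := by nlinarith [norm_nonneg (u x)]
    have h2 : ‖2 - u x ^ 2‖ ≤ 3 := by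
      calc _ ≤ ‖(2 : ℂ)‖ + ‖u x ^ 2‖ := norm_sub_le _ _
        _ ≤ 3 := by rw [norm_pow]; norm_num; linarith
    calc _ ≤ δ * 3 := by gcongr
      _ ≤ η := by linarith

theorem aux_fix {f : Endo n} {a : Cn n} {A : Cn n →L[ℂ] Cn n} (hfa : eapp f a = a)
    (hA : fderiv ℂ (eapp f) a = A) (hu : IsUnit (A - 1)) {W : Set (Cn n →L[ℂ] Cn n)} (hW : W ∈ 𝓝 A)
    {ρ : ℝ} (hρ : 0 < ρ) :
    ∀ᶠ h in 𝓝 f, ∃ p, dist p a < ρ ∧ eapp h p = p ∧ fderiv ℂ (eapp h) p ∈ W := by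
  obtain ⟨u, hu⟩ := hu
  set L : Cn n →L[ℂ] Cn n := ↑u⁻¹ with hL
  have hL1 : L * (A - 1) = 1 := by rw [← hu]; simp [hL]
  have hL2 : (A - 1) * L = 1 := by rw [← hu]; simp [hL]
  obtain ⟨w, hw, hwW⟩ := Metric.mem_nhds_iff.1 hW
  set ε := min (min ρ (w / 2)) (1 / (2 * (‖L‖ + 1))) with hε
  have hLn := norm_nonneg L
  have hε0 : 0 < ε := by positivity
  have hε1 : ε ≤ ρ := (min_le_left _ _).trans (min_le_left _ _)
  have hε2 : ε ≤ w / 2 := (min_le_left _ _).trans (min_le_right _ _)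
  have hε3 : ‖L‖ * ε ≤ 1 / 2 := by
    have : ε ≤ 1 / (2 * (‖L‖ + 1)) := min_le_right _ _
    rw [le_div_iff₀ (by positivity)] at this
    nlinarith
  obtain ⟨r, hr, hrε, hev⟩ := aux_persist f a hε0
  filter_upwards [hev] with h hh
  obtain ⟨h1, h2⟩ := hh
  rw [hfa] at h1
  rw [hA] at h2
  let N : Cn n → Cn n := fun x => x - L (eapp h x - x)
  have hN : ∀ x, HasFDerivAt N (1 - L * (fderiv ℂ (eapp h) x - 1)) x := by
    intro x
    have e1 := ((eapp_diff h x).hasFDerivAt.sub (hasFDerivAt_id x))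
    exact (hasFDerivAt_id x).sub (L.hasFDerivAt.comp x e1)
  have hNb : ∀ x ∈ closedBall a r, ‖1 - L * (fderiv ℂ (eapp h) x - 1)‖₊ ≤ 1 / 2 := by
    intro x hx
    rw [← NNReal.coe_le_coe, coe_nnnorm]
    have : 1 - L * (fderiv ℂ (eapp h) x - 1) = - (L * (fderiv ℂ (eapp h) x - A)) := by
      have e : (1 : Cn n →L[ℂ] Cn n) = L * A - L := by rw [← hL1, mul_sub, mul_one]
      rw [mul_sub, mul_sub, mul_one]
      nth_rewrite 1 [e]
      abel
    rw [this, norm_neg]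
    refine (norm_mul_le _ _).trans ?_
    calc _ ≤ ‖L‖ * ε := by gcongr; exact h2 x hx
      _ ≤ _ := by simpa using hε3
  have hlip : LipschitzOnWith (1 / 2) N (closedBall a r) :=
    (convex_closedBall a r).lipschitzOnWith_of_nnnorm_hasFDerivWithin_le
      (fun x hx => (hN x).hasFDerivWithinAt) hNb
  have hNa : ‖N a - a‖ ≤ r / 2 := by
    have : N a - a = - L (eapp h a - a) := by simp [N]
    rw [this, norm_neg]
    calc _ ≤ ‖L‖ * ‖eapp h a - a‖ := L.le_opNorm _
      _ ≤ ‖L‖ * (ε * r) := by gcongr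
      _ = (‖L‖ * ε) * r := by ring
      _ ≤ 1 / 2 * r := by gcongr
      _ = _ := by ring
  have hmaps : Set.MapsTo N (closedBall a r) (closedBall a r) := by
    intro x hx
    have e1 := hlip.dist_le_mul x hx a (mem_closedBall_self hr.le)
    rw [mem_closedBall] at *
    have e2 := dist_triangle (N x) (N a) a
    rw [← dist_eq_norm] at hNa
    norm_num at e1
    linarith
  have hc : ContractingWith (1 / 2) (hmaps.restrict N _ _) := by
    refine ⟨?_, ?_⟩
    · rw [← NNReal.coe_lt_coe]; norm_num
    · exact hlip.mapsToRestrict hmaps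
  obtain ⟨p, hp, hpf, -⟩ := ContractingWith.exists_fixedPoint' isClosed_closedBall.isComplete hmaps hc
    (mem_closedBall_self hr.le) (edist_ne_top _ _)
  refine ⟨p, ?_, ?_, ?_⟩
  · rw [mem_closedBall] at hp; linarith
  · have e1 : L (eapp h p - p) = 0 := by
      have : p - L (eapp h p - p) = p := hpf
      simpa using this
    have e2 : ((A - 1) * L) (eapp h p - p) = 0 := by
      change (A - 1) (L (eapp h p - p)) = 0
      rw [e1, map_zero]
    rw [hL2] at e2
    exact sub_eq_zero.1 e2
  · apply hwW
    rw [mem_ball, dist_eq_norm]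
    linarith [h2 p hp]

def mkE (φ : Cn n → Cn n) (hφ : Differentiable ℂ φ) : Endo n := ⟨⟨φ, hφ.continuous⟩, hφ⟩

theorem eapp_mkE (φ : Cn n → Cn n) (hφ : Differentiable ℂ φ) : eapp (mkE φ hφ) = φ := rfl

theorem aux_smul_fderiv {H : Cn n → ℂ} {G : Cn n → Cn n} {a : Cn n} (hH : Differentiable ℂ H)
    (hG : Differentiable ℂ G) (h0 : fderiv ℂ H a = 0) :
    HasFDerivAt (fun z => H z • G z) (H a • fderiv ℂ G a) a := by
  have := (hH a).hasFDerivAt.smul (hG a).hasFDerivAt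
  refine this.congr_fderiv ?_
  rw [h0]; ext; simp

theorem aux_exists_norm (hn : 1 ≤ n) {R : ℝ} (hR : 0 ≤ R) : ∃ a : Cn n, ‖a‖ = R := by
  refine ⟨EuclideanSpace.single ⟨0, hn⟩ (R : ℂ), ?_⟩
  simp [abs_of_nonneg hR]

theorem res_of_dense {T : Set (Endo n)} (h : ∀ f : Endo n, ∀ V ∈ 𝓝 f, ∃ g ∈ V, T ∈ 𝓝 g) :
    T ∈ residual (Endo n) := by
  refine mem_of_superset (residual_of_dense_open isOpen_interior ?_) (interior_subset (s := T))
  intro f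
  rw [mem_closure_iff_nhds]
  intro V hV
  obtain ⟨g, hg, hT⟩ := h f V hV
  exact ⟨g, hg, mem_interior_iff_mem_nhds.2 hT⟩

theorem res_fix (hn : 1 ≤ n) (A : Cn n →L[ℂ] Cn n) (hA : (1 : ℂ) ∉ spectrum ℂ A)
    {W : Set (Cn n →L[ℂ] Cn n)} (hW : W ∈ 𝓝 A) :
    {f : Endo n | ∀ K : Set (Cn n), IsCompact K → ∃ p ∉ K, eapp f p = p ∧ fderiv ℂ (eapp f) p ∈ W}
      ∈ residual (Endo n) := by
  have hu : IsUnit (A - 1) := by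
    rw [spectrum.notMem_iff, map_one] at hA
    simpa using hA.neg
  have key : ∀ N : ℕ, {f : Endo n | ∃ p, (N : ℝ) < ‖p‖ ∧ eapp f p = p ∧ fderiv ℂ (eapp f) p ∈ W}
      ∈ residual (Endo n) := by
    intro N
    apply res_of_dense
    intro f V hV
    obtain ⟨R, hRN, ε, hε, hg⟩ := aux_mem_nhds hV N
    have hN0 : (0 : ℝ) ≤ N := N.cast_nonneg
    obtain ⟨a, ha⟩ := aux_exists_norm hn (show 0 ≤ R + 1 by linarith)
    let G : Cn n → Cn n := fun z => a + A (z - a) - eapp f z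
    have hGd : ∀ z, HasFDerivAt G (A - fderiv ℂ (eapp f) z) z := by
      intro z
      have h1 : HasFDerivAt (fun z => a + A (z - a)) A z :=
        (A.hasFDerivAt.comp z ((hasFDerivAt_id z).sub_const a)).const_add a
      exact h1.sub (eapp_diff f z).hasFDerivAt
    have hGd' : Differentiable ℂ G := fun z => (hGd z).differentiableAt
    obtain ⟨C, hC⟩ := (isCompact_closedBall (0 : Cn n) R).exists_bound_of_continuousOn
      hGd'.continuous.continuousOn
    obtain ⟨H, hHd, hHa, hHa', -, hHb⟩ := aux_bump ∅ a (by simp) (show 0 ≤ R by linarith)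
      (by linarith) (show 0 < ε / (|C| + 1) by positivity)
    have hφ : Differentiable ℂ (fun z => eapp f z + H z • G z) :=
      (eapp_diff f).add (hHd.smul hGd')
    set g := mkE _ hφ with hgdef
    have hga : eapp g a = a := by simp [hgdef, eapp_mkE, hHa, G]
    have hgA : fderiv ℂ (eapp g) a = A := by
      have h1 := (eapp_diff f a).hasFDerivAt.add (aux_smul_fderiv hHd hGd' hHa')
      rw [hgdef, eapp_mkE]
      refine h1.fderiv.trans ?_
      rw [hHa, (hGd a).fderiv]
      ext; simp
    refine ⟨g, hg g ?_, ?_⟩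
    · intro x hx
      have : eapp g x - eapp f x = H x • G x := by simp [hgdef, eapp_mkE]
      rw [this, norm_smul]
      calc _ ≤ ε / (|C| + 1) * (|C| + 1) := by
            gcongr
            · exact hHb x hx
            · exact (hC x hx).trans ((le_abs_self _).trans (by linarith))
        _ = ε := by field_simp
    · filter_upwards [aux_fix hga hgA hu hW one_pos] with h ⟨p, hp, h1, h2⟩
      refine ⟨p, ?_, h1, h2⟩
      have := norm_sub_norm_le a p
      rw [dist_comm, dist_eq_norm] at hp
      linarith
  filter_upwards [countable_iInter_mem.2 key] with f hf K hK
  obtain ⟨R, hR⟩ := hK.isBounded.subset_closedBall 0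
  obtain ⟨N, hN⟩ := exists_nat_gt R
  obtain ⟨p, hp, h⟩ := Set.mem_iInter.1 hf N
  refine ⟨p, fun hpK => ?_, h⟩
  have := hR hpK
  rw [mem_closedBall, dist_zero_right] at this
  linarith

theorem aux_spec_upper (A : Cn n →L[ℂ] Cn n) {u : Set ℂ} (hu : IsOpen u) (h : spectrum ℂ A ⊆ u) :
    ∀ᶠ B in 𝓝 A, spectrum ℂ B ⊆ u :=
  (upperHemicontinuous_spectrum ℂ (Cn n →L[ℂ] Cn n)).forall_isOpen A u hu h

theorem aux_eig {A : Cn n →L[ℂ] Cn n} {z : ℂ} (hz : z ∈ spectrum ℂ A) : ∃ v, v ≠ 0 ∧ A v = z • v := by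
  rw [ContinuousLinearMap.spectrum_eq, ← Module.End.hasEigenvalue_iff_mem_spectrum] at hz
  obtain ⟨v, hv⟩ := hz.exists_hasEigenvector
  exact ⟨v, hv.2, hv.apply_eq_smul⟩

theorem aux_eig_mem {A : Cn n →L[ℂ] Cn n} {z : ℂ} {v : Cn n} (hv : v ≠ 0) (h : A v = z • v) :
    z ∈ spectrum ℂ A := by
  rw [ContinuousLinearMap.spectrum_eq, ← Module.End.hasEigenvalue_iff_mem_spectrum]
  exact Module.End.hasEigenvalue_of_hasEigenvector (x := v)
    ⟨Module.End.mem_eigenspace_iff.2 h, hv⟩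

theorem aux_det {B : Cn n →L[ℂ] Cn n} (h : ‖B.det‖ < 1) : ∃ z ∈ spectrum ℂ B, ‖z‖ < 1 := by
  by_contra! hc
  have hs : (LinearMap.charpoly (B : Cn n →ₗ[ℂ] Cn n)).Splits := IsAlgClosed.splits _
  have h1 : B.det = _ := Module.End.det_eq_prod_roots_charpoly_of_splits hs
  rw [h1] at h
  have h2 : ∀ s : Multiset ℂ, (∀ z ∈ s, 1 ≤ ‖z‖) → 1 ≤ ‖s.prod‖ := by
    intro s
    induction s using Multiset.induction_on with
    | empty => simp
    | cons a s ih =>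
      intro hz
      rw [Multiset.prod_cons, norm_mul]
      have e1 := hz a (Multiset.mem_cons_self _ _)
      have e2 := ih (fun z hzz => hz z (Multiset.mem_cons_of_mem hzz))
      nlinarith
  refine absurd h (not_lt.2 (h2 _ ?_))
  intro z hz
  apply hc
  rw [ContinuousLinearMap.spectrum_eq, Module.End.mem_spectrum_iff_isRoot_charpoly]
  exact (Polynomial.mem_roots'.1 hz).2

theorem aux_spec_lower {A : Cn n →L[ℂ] Cn n} {c : ℂ} {v : Cn n} (hv : v ≠ 0) (h : A v = c • v) :
    ∀ᶠ B in 𝓝 A, ∃ z ∈ spectrum ℂ B, ‖z - c‖ < 1 := by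
  have h0 : (A - algebraMap ℂ _ c).det = 0 := by
    by_contra hd
    have hu : IsUnit (LinearMap.det ((A - algebraMap ℂ _ c : Cn n →L[ℂ] Cn n) : Cn n →ₗ[ℂ] Cn n)) :=
      isUnit_iff_ne_zero.2 hd
    rw [← LinearMap.isUnit_iff_isUnit_det] at hu
    have hinj := ((Module.End.isUnit_iff _).1 hu).1
    apply hv
    apply hinj
    simp [h, Algebra.algebraMap_eq_smul_one]
  have hcont : Continuous fun B : Cn n →L[ℂ] Cn n => ‖(B - algebraMap ℂ _ c).det‖ :=
    (ContinuousLinearMap.continuous_det.comp (continuous_id.sub continuous_const)).norm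
  have := hcont.tendsto A
  rw [h0, norm_zero] at this
  filter_upwards [this.eventually (gt_mem_nhds one_pos)] with B hB
  obtain ⟨z, hz, hz1⟩ := aux_det hB
  refine ⟨z + c, ?_, by simpa using hz1⟩
  obtain ⟨v, hv, hve⟩ := aux_eig hz
  apply aux_eig_mem hv
  have e : B v - c • v = z • v := by simpa [Algebra.algebraMap_eq_smul_one] using hve
  rw [add_smul, ← e, sub_add_cancel]

theorem res_att (hn : 1 ≤ n) : {f : Endo n | ∀ K : Set (Cn n), IsCompact K → ∃ p ∉ K, IsAttFix f p}
    ∈ residual (Endo n) := by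
  have : Nonempty (Fin n) := ⟨⟨0, hn⟩⟩
  have hs : spectrum ℂ (0 : Cn n →L[ℂ] Cn n) = {0} := spectrum.zero_eq
  have hW := aux_spec_upper (0 : Cn n →L[ℂ] Cn n) (isOpen_ball (x := (0 : ℂ)) (ε := 1)) (by simp [hs])
  filter_upwards [res_fix hn 0 (by simp [hs]) hW] with f hf K hK
  obtain ⟨p, hp, h1, h2⟩ := hf K hK
  exact ⟨p, hp, h1, fun z hz => by simpa using h2 hz⟩

theorem res_rep (hn : 1 ≤ n) : {f : Endo n | ∀ K : Set (Cn n), IsCompact K → ∃ p ∉ K, IsRepFix f p}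
    ∈ residual (Endo n) := by
  have : Nonempty (Fin n) := ⟨⟨0, hn⟩⟩
  have hs : spectrum ℂ (algebraMap ℂ (Cn n →L[ℂ] Cn n) 2) = {2} := spectrum.scalar_eq 2
  have ho : IsOpen {z : ℂ | 1 < ‖z‖} := isOpen_lt continuous_const continuous_norm
  have hW := aux_spec_upper _ ho (by rw [hs]; simp)
  filter_upwards [res_fix hn _ (by simp [hs]) hW] with f hf K hK
  obtain ⟨p, hp, h1, h2⟩ := hf K hK
  exact ⟨p, hp, h1, fun z hz => h2 hz⟩

theorem res_sad (hn : 2 ≤ n) : {f : Endo n | ∀ K : Set (Cn n), IsCompact K → ∃ p ∉ K, IsSadFix f p}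
    ∈ residual (Endo n) := by
  let i0 : Fin n := ⟨0, by omega⟩
  let i1 : Fin n := ⟨1, by omega⟩
  have hi : i1 ≠ i0 := by simp [i0, i1]
  let e0 : Cn n := EuclideanSpace.single i0 1
  let e1 : Cn n := EuclideanSpace.single i1 1
  have he0 : e0 ≠ 0 := by simp [e0]
  have he1 : e1 ≠ 0 := by simp [e1]
  let A : Cn n →L[ℂ] Cn n := (EuclideanSpace.proj i0 : Cn n →L[ℂ] ℂ).smulRight ((3 : ℂ) • e0)
  have hA : ∀ v, A v = v i0 • (3 : ℂ) • e0 := fun v => rfl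
  have hA0 : A e0 = (3 : ℂ) • e0 := by rw [hA]; simp [e0]
  have hA1 : A e1 = (0 : ℂ) • e1 := by rw [hA]; simp [e1, hi.symm]
  have hs : ∀ z ∈ spectrum ℂ A, z = 0 ∨ z = 3 := by
    intro z hz
    obtain ⟨v, hv, hve⟩ := aux_eig hz
    have h2 : A (A v) = (3 : ℂ) • A v := by
      conv_lhs => rw [hA v]
      rw [map_smul, map_smul, hA0, hA v, smul_comm]
    rw [hve, map_smul, hve, smul_smul, smul_smul, ← sub_eq_zero, ← sub_smul, smul_eq_zero] at h2
    have h3 := h2.resolve_right hv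
    have : z * (z - 3) = 0 := by linear_combination h3
    rcases mul_eq_zero.1 this with h | h
    · exact Or.inl h
    · exact Or.inr (sub_eq_zero.1 h)
  have ho : IsOpen {z : ℂ | ‖z‖ ≠ 1} := isOpen_ne_fun continuous_norm continuous_const
  have hW := (aux_spec_upper A ho (fun z hz => by rcases hs z hz with rfl | rfl <;> simp)).and
    ((aux_spec_lower he0 hA0).and (aux_spec_lower he1 hA1))
  have h1 : (1 : ℂ) ∉ spectrum ℂ A := fun h => by rcases hs 1 h with h | h <;> norm_num at h
  filter_upwards [res_fix (by omega) A h1 hW] with f hf K hK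
  obtain ⟨p, hp, h1, h2, ⟨z, hz, hz3⟩, ⟨w, hw, hw0⟩⟩ := hf K hK
  refine ⟨p, hp, h1, fun z hz => h2 hz, ⟨w, hw, by simpa using hw0⟩, ⟨z, hz, ?_⟩⟩
  have := norm_sub_norm_le (3 : ℂ) z
  rw [norm_sub_rev] at hz3
  norm_num at this
  linarith

theorem rep_julia (hn : 1 ≤ n) {f : Endo n} {p : Cn n} (hp : IsRepFix f p) : p ∈ Julia f := by
  have : Nonempty (Fin n) := ⟨⟨0, hn⟩⟩
  intro hF
  obtain ⟨hfp, hsp⟩ := hp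
  obtain ⟨U, hU, hpU, hk⟩ := hF
  obtain ⟨l, hl, hor⟩ := hk id strictMono_id
  have hit : ∀ k, (eapp f)^[k] p = p := fun k => Function.iterate_fixed hfp k
  rcases hor with ⟨g, -, hg⟩ | hdiv
  · obtain ⟨c, hc⟩ := spectrum.nonempty (fderiv ℂ (eapp f) p)
    have hc1 := hsp c hc
    obtain ⟨v, hv, hve⟩ := aux_eig hc
    let γ : ℂ → Cn n := fun t => p + t • v
    have hγd : ∀ t, HasDerivAt γ v t := by
      intro t
      have := ((hasDerivAt_id t).smul_const v).const_add p
      rw [one_smul] at this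
      exact this
    have hγc : Continuous γ := continuous_iff_continuousAt.2 fun t => (hγd t).continuousAt
    have hU' : IsOpen (γ ⁻¹' U) := hU.preimage hγc
    have h0 : (0 : ℂ) ∈ γ ⁻¹' U := by simpa [γ] using hpU
    have h1 := hg.comp γ (Set.mapsTo_preimage γ U) hγc.continuousOn
    have h2 := h1.deriv (Eventually.of_forall fun j => by
      apply Differentiable.differentiableOn
      exact (iter_diff f _).comp (fun t => (hγd t).differentiableAt)) hU'
    have h3 := (h2.tendsto_at h0).norm
    have hpow : ∀ k : ℕ, ((fderiv ℂ (eapp f) p) ^ k) v = c ^ k • v := by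
      intro k
      induction k with
      | zero => simp
      | succ k ih =>
        rw [pow_succ]
        change ((fderiv ℂ (eapp f) p) ^ k) ((fderiv ℂ (eapp f) p) v) = _
        rw [hve, map_smul, ih, smul_smul, pow_succ, mul_comm]
    have hd : ∀ j, deriv ((eapp f)^[id (l j)] ∘ γ) 0 = c ^ (l j) • v := by
      intro j
      have e1 : HasFDerivAt ((eapp f)^[l j]) ((fderiv ℂ (eapp f) p) ^ (l j)) (γ 0) := by
        have : γ 0 = p := by simp [γ]
        rw [this]
        exact (eapp_diff f p).hasFDerivAt.iterate hfp (l j)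
      have := e1.comp_hasDerivAt 0 (hγd 0)
      rw [hpow] at this
      exact this.deriv
    have h4 : Tendsto (fun j => ‖c‖ ^ (l j) * ‖v‖) atTop atTop :=
      ((tendsto_pow_atTop_atTop_of_one_lt hc1).comp hl.tendsto_atTop).atTop_mul_const
        (norm_pos_iff.2 hv)
    refine not_tendsto_nhds_of_tendsto_atTop h4 _ (h3.congr fun j => ?_)
    have := hd j
    simp only [comp_apply] at this ⊢
    rw [← norm_pow, ← norm_smul, ← this]
  · have := hdiv {p} (by simpa using hpU) isCompact_singleton {p} isCompact_singleton
    obtain ⟨j, hj⟩ := this.exists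
    simp [hit] at hj

theorem aux_ident {g : Cn n → Cn n} {x z c : Cn n} {ρ : ℝ} (hg : DifferentiableOn ℂ g (ball x ρ))
    (hz : z ∈ ball x ρ) (h : ∀ᶠ w in 𝓝 z, g w = c) : ∀ w ∈ ball x ρ, g w = c := by
  intro w hw
  let γ : ℂ → Cn n := fun t => z + t • (w - z)
  have hγd : Differentiable ℂ γ := by
    intro t
    exact ((differentiableAt_id (x := t)).smul_const (w - z)).const_add z
  have hT : IsOpen (γ ⁻¹' ball x ρ) := isOpen_ball.preimage hγd.continuous
  have hconv : Convex ℝ (γ ⁻¹' ball x ρ) := by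
    intro s hs t ht a b ha hb hab
    have e : γ (a • s + b • t) = a • γ s + b • γ t := by
      have h1 : z = (a + b) • z := by rw [hab, one_smul]
      simp only [γ, smul_add, add_smul, smul_assoc]
      nth_rewrite 1 [h1]
      rw [add_smul]; abel
    rw [Set.mem_preimage, e]
    exact convex_ball x ρ hs ht ha hb hab
  have han : AnalyticOnNhd ℂ (g ∘ γ) (γ ⁻¹' ball x ρ) :=
    (hg.comp hγd.differentiableOn (Set.mapsTo_preimage _ _)).analyticOnNhd hT
  have h0 : (0 : ℂ) ∈ γ ⁻¹' ball x ρ := by simpa [γ] using hz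
  have h1 : (1 : ℂ) ∈ γ ⁻¹' ball x ρ := by simpa [γ] using hw
  have hev : g ∘ γ =ᶠ[𝓝 0] fun _ => c := by
    have : Tendsto γ (𝓝 0) (𝓝 z) := by simpa [γ] using hγd.continuous.tendsto 0
    exact this.eventually h
  have := han.eqOn_of_preconnected_of_eventuallyEq analyticOnNhd_const hconv.isPreconnected h0 hev h1
  simpa [γ] using this

def Trap (h : Endo n) (q : Cn n) (r : ℝ) : Prop :=
  0 < r ∧ LipschitzOnWith (1 / 2) (eapp h) (closedBall q r) ∧ dist (eapp h q) q ≤ r / 4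

theorem Trap.maps {h : Endo n} {q : Cn n} {r : ℝ} (ht : Trap h q r) {x : Cn n}
    (hx : x ∈ closedBall q r) : eapp h x ∈ closedBall q (3 * r / 4) := by
  obtain ⟨h0, h1, h2⟩ := ht
  have := h1.dist_le_mul x hx q (mem_closedBall_self h0.le)
  rw [mem_closedBall] at *
  have e2 := dist_triangle (eapp h x) (eapp h q) q
  norm_num at this
  linarith

theorem Trap.iter {h : Endo n} {q : Cn n} {r : ℝ} (ht : Trap h q r) {x : Cn n}
    (hx : x ∈ closedBall q r) (k : ℕ) : (eapp h)^[k] x ∈ closedBall q r := by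
  induction k with
  | zero => exact hx
  | succ k ih =>
    rw [iterate_succ_apply']
    exact closedBall_subset_closedBall (by linarith [ht.1]) (ht.maps ih)

theorem Trap.iter_dist {h : Endo n} {q : Cn n} {r : ℝ} (ht : Trap h q r) {x y : Cn n}
    (hx : x ∈ closedBall q r) (hy : y ∈ closedBall q r) (k : ℕ) :
    dist ((eapp h)^[k] x) ((eapp h)^[k] y) ≤ (1 / 2) ^ k * dist x y := by
  induction k with
  | zero => simp
  | succ k ih =>
    rw [iterate_succ_apply', iterate_succ_apply']
    have := ht.2.1.dist_le_mul _ (ht.iter hx k) _ (ht.iter hy k)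
    norm_num at this ih ⊢
    rw [pow_succ]
    linarith

theorem Trap.late {h : Endo n} {q : Cn n} {r : ℝ} (ht : Trap h q r) {x : Cn n} {k₀ k : ℕ}
    (hx : (eapp h)^[k₀] x ∈ ball q r) (hk : k₀ ≤ k) : (eapp h)^[k] x ∈ closedBall q r := by
  obtain ⟨d, rfl⟩ := Nat.exists_eq_add_of_le hk
  rw [add_comm, iterate_add_apply]
  exact ht.iter (ball_subset_closedBall hx) d

theorem Trap.late' {h : Endo n} {q : Cn n} {r : ℝ} (ht : Trap h q r) {x : Cn n} {k₀ k : ℕ}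
    (hx : (eapp h)^[k₀] x ∈ ball q r) (hk : k₀ < k) : (eapp h)^[k] x ∈ closedBall q (3 * r / 4) := by
  obtain ⟨d, rfl⟩ := Nat.exists_eq_add_of_lt hk
  rw [iterate_succ_apply']
  exact ht.maps (ht.late hx (by omega))

theorem Trap.local {h : Endo n} {q : Cn n} {r : ℝ} (ht : Trap h q r) {x : Cn n}
    (hF : FatouAt h x) (hx : x ∈ closure {z | ∃ k, (eapp h)^[k] z ∈ ball q r}) :
    ∃ k, (eapp h)^[k] x ∈ ball q r := by
  obtain ⟨U, hU, hxU, hk⟩ := hF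
  obtain ⟨ρ, hρ, hρU⟩ := Metric.isOpen_iff.1 hU x hxU
  obtain ⟨z, hzW, k₀, hz⟩ := mem_closure_iff.1 hx (ball x ρ) isOpen_ball (mem_ball_self hρ)
  obtain ⟨l, hl, hor⟩ := hk id strictMono_id
  have hlt := hl.tendsto_atTop
  rcases hor with ⟨g, hgd, hg⟩ | hdiv
  · have hpt : ∀ w ∈ ball x ρ, Tendsto (fun j => (eapp h)^[l j] w) atTop (𝓝 (g w)) :=
      fun w hw => hg.tendsto_at (hρU hw)
    have hconst : ∀ᶠ w in 𝓝 z, g w = g z := by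
      have e1 : ∀ᶠ w in 𝓝 z, (eapp h)^[k₀] w ∈ ball q r :=
        (iter_cont h k₀).continuousAt.eventually (isOpen_ball.mem_nhds hz)
      filter_upwards [e1, isOpen_ball.mem_nhds hzW] with w hw hwW
      have e2 := (hpt w hwW).dist (hpt z hzW)
      have e3 : Tendsto (fun j => (1 / 2 : ℝ) ^ (l j - k₀) *
          dist ((eapp h)^[k₀] w) ((eapp h)^[k₀] z)) atTop 
          (𝓝 (0 * dist ((eapp h)^[k₀] w) ((eapp h)^[k₀] z))) := by
        refine Tendsto.mul_const _ ?_
        exact (tendsto_pow_atTop_nhds_zero_of_lt_one (by norm_num) (by norm_num)).comp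
          ((tendsto_sub_atTop_nat k₀).comp hlt)
      rw [zero_mul] at e3
      have e4 : dist (g w) (g z) ≤ 0 := by
        refine le_of_tendsto_of_tendsto e2 e3 ?_
        filter_upwards [hlt.eventually_ge_atTop k₀] with j hj
        obtain ⟨d, hd⟩ := Nat.exists_eq_add_of_le hj
        rw [hd, Nat.add_sub_cancel_left, add_comm, iterate_add_apply, iterate_add_apply]
        exact ht.iter_dist (ball_subset_closedBall hw) (ball_subset_closedBall hz) d
      exact dist_le_zero.1 e4
    have hgx : g x = g z := aux_ident (hgd.mono hρU) hzW hconst x (mem_ball_self hρ)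
    have hgz : g z ∈ closedBall q (3 * r / 4) := by
      refine isClosed_closedBall.mem_of_tendsto (hpt z hzW) ?_
      filter_upwards [hlt.eventually_gt_atTop k₀] with j hj
      exact ht.late' hz hj
    have hb : g x ∈ ball q r := by
      rw [hgx]
      exact closedBall_subset_ball (by linarith [ht.1]) hgz
    obtain ⟨j, hj⟩ := ((hpt x (mem_ball_self hρ)).eventually (isOpen_ball.mem_nhds hb)).exists
    exact ⟨_, hj⟩
  · exfalso
    have e1 := hdiv {z} (by simpa using hρU hzW) isCompact_singleton (closedBall q r)
      (isCompact_closedBall _ _)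
    obtain ⟨j, hj, hj2⟩ := (e1.and (hlt.eventually_ge_atTop k₀)).exists
    rw [Set.image_singleton, Set.disjoint_singleton_left] at hj
    exact hj (ht.late hz hj2)

theorem julia_of_traps {h : Endo n} {b b' : Cn n} {r r' : ℝ} (ht : Trap h b r) (ht' : Trap h b' r')
    (hd : Disjoint (closedBall b r) (closedBall b' r')) {c y y' : Cn n} {δ : ℝ}
    (hy : y ∈ ball c δ) (hy' : y' ∈ ball c δ) {m m' : ℕ} (hm : (eapp h)^[m] y ∈ ball b r)
    (hm' : (eapp h)^[m'] y' ∈ ball b' r') : (Julia h ∩ ball c δ).Nonempty := by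
  by_contra hne
  have hF : ∀ x ∈ ball c δ, FatouAt h x := by
    intro x hx
    by_contra hJ
    exact hne ⟨x, hJ, hx⟩
  have hE : IsOpen {z | ∃ k, (eapp h)^[k] z ∈ ball b r} := by
    rw [Set.ofPred_exists]
    exact isOpen_iUnion fun k => isOpen_ball.preimage (iter_cont h k)
  have hsub := (convex_ball c δ).isPreconnected.subset_of_closure_inter_subset hE
    ⟨y, hy, m, hm⟩ (fun x hx => ht.local (hF x hx.2) hx.1)
  obtain ⟨k, hk⟩ := hsub hy'
  exact Set.disjoint_left.1 hd (ht.late hk (le_max_left k m')) (ht'.late hm' (le_max_right k m'))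

theorem cont_iter (m : ℕ) (y : Cn n) : Continuous fun h : Endo n => (eapp h)^[m] y := by
  induction m with
  | zero => exact continuous_const
  | succ m ih =>
    simp only [iterate_succ_apply']
    exact Continuous.eval continuous_subtype_val ih

theorem aux_trap {g : Endo n} {b : Cn n} (hb : eapp g b = b) (hd : fderiv ℂ (eapp g) b = 0)
    {ρ : ℝ} (hρ : 0 < ρ) : ∃ r > 0, r < ρ ∧ ∀ᶠ h in 𝓝 g, Trap h b r := by
  have hε : 0 < min ρ (1 / 4) := by positivity
  obtain ⟨r, hr, hrε, hev⟩ := aux_persist g b hε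
  refine ⟨r, hr, hrε.trans_le (min_le_left _ _), ?_⟩
  filter_upwards [hev] with h hh
  obtain ⟨h1, h2⟩ := hh
  rw [hb, ← dist_eq_norm] at h1
  have h4 : min ρ (1 / 4) ≤ 1 / 4 := min_le_right _ _
  refine ⟨hr, ?_, ?_⟩
  · refine Convex.lipschitzOnWith_of_nnnorm_hasFDerivWithin_le (𝕜 := ℂ)
      (fun x _ => (eapp_diff h x).hasFDerivAt.hasFDerivWithinAt) (fun x hx => ?_)
      (convex_closedBall b r)
    have := h2 x hx
    rw [hd, sub_zero] at this
    rw [← NNReal.coe_le_coe, coe_nnnorm]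
    norm_num
    linarith
  · refine h1.trans ?_
    nlinarith

theorem aux_eq_iter {φ ψ : Cn n → Cn n} {y : Cn n} {m : ℕ} (h : ∀ i < m, ψ (φ^[i] y) = φ (φ^[i] y)) :
    ψ^[m] y = φ^[m] y := by
  induction m with
  | zero => rfl
  | succ m ih =>
    rw [iterate_succ_apply', iterate_succ_apply', ih fun i hi => h i (by omega), h m (by omega)]

theorem aux_nonconst {f : Endo n} {y : Cn n} (hy : ¬ ∃ R, ∀ k, ‖(eapp f)^[k] y‖ ≤ R) (m : ℕ) :
    ∃ᶠ w in 𝓝 y, (eapp f)^[m] w ≠ (eapp f)^[m] y := by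
  intro hc
  simp only [not_not] at hc
  have hall : ∀ w, (eapp f)^[m] w = (eapp f)^[m] y := by
    intro w
    refine aux_ident (x := y) (ρ := dist w y + 1) (iter_diff f m).differentiableOn ?_ hc w ?_
    · exact mem_ball_self (by positivity)
    · rw [mem_ball]; linarith
  apply hy
  refine ⟨∑ i ∈ Finset.range (m + 1), ‖(eapp f)^[i] y‖, fun k => ?_⟩
  by_cases hk : k ≤ m
  · exact Finset.single_le_sum (f := fun i => ‖(eapp f)^[i] y‖) (fun _ _ => norm_nonneg _)
      (Finset.mem_range.2 (by omega))
  · obtain ⟨d, rfl⟩ := Nat.exists_eq_add_of_le (not_le.1 hk).le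
    rw [iterate_add_apply, hall]
    exact Finset.single_le_sum (f := fun i => ‖(eapp f)^[i] y‖) (fun _ _ => norm_nonneg _)
      (Finset.mem_range.2 (by omega))

theorem aux_unb {f : Endo n} {y : Cn n} (hy : ¬ ∃ R, ∀ k, ‖(eapp f)^[k] y‖ ≤ R)
    {U : Set (Cn n)} (hU : IsOpen U) (hyU : y ∈ U) {V : Set (Endo n)} (hV : V ∈ 𝓝 f) :
    ∃ g ∈ V, {h : Endo n | (Julia h ∩ U).Nonempty} ∈ 𝓝 g := by
  classical
  obtain ⟨R, hR, ε, hε, hRV⟩ := aux_mem_nhds hV 0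
  obtain ⟨δ, hδ, hδU⟩ := Metric.isOpen_iff.1 hU y hyU
  have hex : ∃ m, R < ‖(eapp f)^[m] y‖ := by
    by_contra! hc
    exact hy ⟨R, hc⟩
  obtain ⟨m, hm, hmin⟩ : ∃ m, R < ‖(eapp f)^[m] y‖ ∧ ∀ i < m, ‖(eapp f)^[i] y‖ ≤ R :=
    ⟨Nat.find hex, Nat.find_spec hex, fun i hi => not_lt.1 (Nat.find_min hex hi)⟩
  obtain ⟨R', hR1, hR2⟩ := exists_between hm
  have hev : ∀ᶠ w in 𝓝 y, w ∈ ball y δ ∧ R' < ‖(eapp f)^[m] w‖ ∧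
      ∀ i ∈ Finset.range m, ‖(eapp f)^[i] w‖ < R' := by
    refine Filter.Eventually.and (ball_mem_nhds y hδ) (Filter.Eventually.and ?_ ?_)
    · exact (iter_cont f m).norm.continuousAt.eventually (lt_mem_nhds hR2)
    · rw [Filter.eventually_all_finset]
      intro i hi
      exact (iter_cont f i).norm.continuousAt.eventually
        (gt_mem_nhds ((hmin i (Finset.mem_range.1 hi)).trans_lt hR1))
  obtain ⟨y', hne, hyδ, hm', hmin'⟩ := ((aux_nonconst hy m).and_eventually hev).exists
  set b := (eapp f)^[m] y with hb
  set b' := (eapp f)^[m] y' with hb'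
  let S : Finset (Cn n) := (Finset.range m).image (fun i => (eapp f)^[i] y) ∪
    (Finset.range m).image (fun i => (eapp f)^[i] y')
  have hS : ∀ s ∈ S, ‖s‖ < R' := by
    intro s hs
    simp only [S, Finset.mem_union, Finset.mem_image, Finset.mem_range] at hs
    rcases hs with ⟨i, hi, rfl⟩ | ⟨i, hi, rfl⟩
    · exact (hmin i hi).trans_lt hR1
    · exact hmin' i (Finset.mem_range.2 hi)
  have hbS : b ∉ insert b' S := by
    intro h
    rcases Finset.mem_insert.1 h with h | h
    · exact hne h.symm
    · exact lt_asymm hR2 (hS _ h)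
  have hbS' : b' ∉ insert b S := by
    intro h
    rcases Finset.mem_insert.1 h with h | h
    · exact hne h
    · exact lt_asymm hm' (hS _ h)
  obtain ⟨M, hM⟩ := ((isCompact_closedBall (0 : Cn n) R).image (eapp_cont f)).isBounded.exists_norm_le
  have hM0 : 0 ≤ M := (norm_nonneg _).trans
    (hM (eapp f 0) ⟨0, mem_closedBall_self hR.le, rfl⟩)
  have hη : 0 < ε / (2 * (‖b‖ + ‖b'‖ + M + 1)) := by positivity
  obtain ⟨H, hHd, hHb, hHb0, hHS, hHs⟩ := aux_bump _ b hbS hR.le hm hη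
  obtain ⟨H', hHd', hHb', hHb0', hHS', hHs'⟩ := aux_bump _ b' hbS' hR.le (hR1.trans hm') hη
  let G : Cn n → Cn n := fun z => eapp f z + H z • (b - eapp f z) + H' z • (b' - eapp f z)
  have hfd := eapp_diff f
  have hGd : Differentiable ℂ G :=
    (hfd.add (hHd.smul (hfd.const_sub b))).add (hHd'.smul (hfd.const_sub b'))
  have hGS : ∀ s ∈ S, G s = eapp f s := by
    intro s hs
    simp [G, (hHS s (Finset.mem_insert_of_mem hs)).1, (hHS' s (Finset.mem_insert_of_mem hs)).1]
  have hGb : G b = b := by simp [G, hHb, (hHS' b (Finset.mem_insert_self _ _)).1]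
  have hGb' : G b' = b' := by simp [G, hHb', (hHS b' (Finset.mem_insert_self _ _)).1]
  have hGf : ∀ c, fderiv ℂ H c = 0 → fderiv ℂ H' c = 0 → HasFDerivAt G (fderiv ℂ (eapp f) c +
      H c • fderiv ℂ (fun z => b - eapp f z) c + H' c • fderiv ℂ (fun z => b' - eapp f z) c) c := by
    intro c h1 h2
    exact ((hfd c).hasFDerivAt.add (aux_smul_fderiv hHd (hfd.const_sub b) h1)).add
      (aux_smul_fderiv hHd' (hfd.const_sub b') h2)
  have hGfb : fderiv ℂ G b = 0 := by
    rw [(hGf b hHb0 (hHS' b (Finset.mem_insert_self _ _)).2).fderiv, hHb,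
      (hHS' b (Finset.mem_insert_self _ _)).1, fderiv_const_sub]
    ext v; simp
  have hGfb' : fderiv ℂ G b' = 0 := by
    rw [(hGf b' (hHS b' (Finset.mem_insert_self _ _)).2 hHb0').fderiv, hHb',
      (hHS b' (Finset.mem_insert_self _ _)).1, fderiv_const_sub b']
    ext v; simp
  have hGm : G^[m] y = b := aux_eq_iter fun i hi => hGS _ (by
    simp only [S, Finset.mem_union, Finset.mem_image, Finset.mem_range]
    exact Or.inl ⟨i, hi, rfl⟩)
  have hGm' : G^[m] y' = b' := aux_eq_iter fun i hi => hGS _ (by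
    simp only [S, Finset.mem_union, Finset.mem_image, Finset.mem_range]
    exact Or.inr ⟨i, hi, rfl⟩)
  refine ⟨mkE G hGd, hRV _ fun x hx => ?_, ?_⟩
  · rw [eapp_mkE]
    have e : G x - eapp f x = H x • (b - eapp f x) + H' x • (b' - eapp f x) := by
      simp only [G]; abel
    rw [e]
    have e1 : ‖eapp f x‖ ≤ M := hM _ ⟨x, hx, rfl⟩
    have e2 : ‖b - eapp f x‖ ≤ ‖b‖ + ‖b'‖ + M + 1 :=
      (norm_sub_le _ _).trans (by linarith [norm_nonneg b'])
    have e3 : ‖b' - eapp f x‖ ≤ ‖b‖ + ‖b'‖ + M + 1 :=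
      (norm_sub_le _ _).trans (by linarith [norm_nonneg b])
    have e4 := hHs x hx
    have e5 := hHs' x hx
    refine (norm_add_le _ _).trans ?_
    rw [norm_smul, norm_smul]
    calc _ ≤ ε / (2 * (‖b‖ + ‖b'‖ + M + 1)) * (‖b‖ + ‖b'‖ + M + 1) +
          ε / (2 * (‖b‖ + ‖b'‖ + M + 1)) * (‖b‖ + ‖b'‖ + M + 1) := by gcongr
      _ = ε := by field_simp; ring
  · have hdist : 0 < dist b b' / 2 := half_pos (dist_pos.2 fun h => hne h.symm)
    obtain ⟨r, hr, hrd, ht⟩ := aux_trap (g := mkE G hGd) hGb hGfb hdist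
    obtain ⟨r', hr', hrd', ht'⟩ := aux_trap (g := mkE G hGd) hGb' hGfb' hdist
    have hc := (cont_iter m y).continuousAt (x := mkE G hGd)
    have hc' := (cont_iter m y').continuousAt (x := mkE G hGd)
    have k1 : ball b r ∈ 𝓝 ((eapp (mkE G hGd))^[m] y) := by
      rw [eapp_mkE, hGm]; exact ball_mem_nhds _ hr
    have k2 : ball b' r' ∈ 𝓝 ((eapp (mkE G hGd))^[m] y') := by
      rw [eapp_mkE, hGm']; exact ball_mem_nhds _ hr'
    filter_upwards [ht, ht', hc k1, hc' k2] with h h1 h2 h3 h4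
    have := julia_of_traps h1 h2 (closedBall_disjoint_closedBall (by linarith))
      (mem_ball_self hδ) hyδ h3 h4
    exact this.mono (Set.inter_subset_inter_right _ hδU)

theorem aux_lim {X E : Type*} [MetricSpace E] [CompleteSpace E] {F : ℕ → X → E} {s : Set X}
    (hF : UniformCauchySeqOn F atTop s) : ∃ g : X → E, TendstoUniformlyOn F g atTop s := by
  classical
  have hx : ∀ x, ∃ y, x ∈ s → Tendsto (fun j => F j x) atTop (𝓝 y) := by
    intro x
    by_cases hx : x ∈ s
    · obtain ⟨y, hy⟩ := cauchySeq_tendsto_of_complete (hF.cauchySeq hx)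
      exact ⟨y, fun _ => hy⟩
    · exact ⟨F 0 x, fun h => absurd h hx⟩
  choose g hg using hx
  exact ⟨g, hF.tendstoUniformlyOn_of_tendsto hg⟩

theorem aux_holo {F : ℕ → Cn n → Cn n} (hd : ∀ j, Differentiable ℂ (F j)) {p : Cn n} {ρ : ℝ}
    (hF : UniformCauchySeqOn F atTop (ball p ρ)) :
    ∃ g, DifferentiableOn ℂ g (ball p ρ) ∧ TendstoLocallyUniformlyOn F g atTop (ball p ρ) := by
  obtain ⟨g, hg⟩ := aux_lim hF
  refine ⟨g, fun w hw => ?_, hg.tendstoLocallyUniformlyOn⟩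
  rw [mem_ball] at hw
  set σ := (ρ - dist w p) / 2 with hσ
  have hσ0 : 0 < σ := by rw [hσ]; linarith
  have hsub : ∀ x ∈ ball w σ, ball x σ ⊆ ball p ρ := by
    intro x hx z hz
    rw [mem_ball] at *
    have := dist_triangle4 z x w p
    linarith
  have hC : UniformCauchySeqOn (fun j => fderiv ℂ (F j)) atTop (ball w σ) := by
    rw [Metric.uniformCauchySeqOn_iff] at hF ⊢
    intro ε hε
    obtain ⟨N, hN⟩ := hF (ε * σ / 4) (by positivity)
    refine ⟨N, fun i hi j hj x hx => ?_⟩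
    have key : ‖fderiv ℂ (fun z => F i z - F j z) x‖ ≤ 2 * (ε * σ / 4) / σ := by
      apply aux_cauchy hσ0
      · exact ((hd i).sub (hd j)).differentiableOn
      · intro z hz
        rw [← dist_eq_norm]
        exact (hN i hi j hj z (hsub x hx hz)).le
    rw [fderiv_fun_sub (hd i x) (hd j x), ← dist_eq_norm] at key
    have : 2 * (ε * σ / 4) / σ = ε / 2 := by field_simp; ring
    linarith
  obtain ⟨g', hg'⟩ := aux_lim hC
  have hs : ball w σ ⊆ ball p ρ := by
    have := hsub w (mem_ball_self hσ0)
    exact this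
  have := hasFDerivAt_of_tendstoUniformlyOn isOpen_ball hg' (fun j x _ => (hd j x).hasFDerivAt)
    (fun x hx => hg.tendsto_at (hs hx)) (mem_ball_self hσ0)
  exact this.differentiableAt.differentiableWithinAt

theorem aux_sub {F : ℕ → Cn n → Cn n} {s : Set (Cn n)} (hF : UniformCauchySeqOn F atTop s)
    {l : ℕ → ℕ} (hl : StrictMono l) : UniformCauchySeqOn (fun j => F (l j)) atTop s := by
  rw [Metric.uniformCauchySeqOn_iff] at hF ⊢
  intro ε hε
  obtain ⟨N, hN⟩ := hF ε hε
  exact ⟨N, fun i hi j hj x hx => hN _ (hi.trans (hl.id_le i)) _ (hj.trans (hl.id_le j)) x hx⟩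

theorem aux_perf (hn : 1 ≤ n) {f : Endo n} {p : Cn n} {ρ : ℝ} (hρ : 0 < ρ)
    (hF : ∀ x ∈ ball p ρ, x ≠ p → FatouAt f x ∧ ∃ R, ∀ k, ‖(eapp f)^[k] x‖ ≤ R) : FatouAt f p := by
  have : Nonempty (Fin n) := ⟨⟨0, hn⟩⟩
  refine ⟨ball p (ρ / 2), isOpen_ball, mem_ball_self (by positivity), fun k hk => ?_⟩
  have hS : ∀ k : ℕ → ℕ, StrictMono k → ∃ l : ℕ → ℕ, StrictMono l ∧
      UniformCauchySeqOn (fun j => (eapp f)^[k (l j)]) atTop (sphere p (ρ / 2)) := by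
    refine (isCompact_sphere p (ρ / 2)).induction_on (p := fun s => ∀ k : ℕ → ℕ, StrictMono k →
      ∃ l : ℕ → ℕ, StrictMono l ∧ UniformCauchySeqOn (fun j => (eapp f)^[k (l j)]) atTop s)
      ?_ ?_ ?_ ?_
    · intro k _
      refine ⟨id, strictMono_id, ?_⟩
      rw [Metric.uniformCauchySeqOn_iff]
      intro ε _
      exact ⟨0, fun _ _ _ _ x hx => absurd hx (Set.notMem_empty x)⟩
    · intro s t hst ht k hk
      obtain ⟨l, hl, h⟩ := ht k hk
      exact ⟨l, hl, h.mono hst⟩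
    · intro s t hs ht k hk
      obtain ⟨l, hl, h⟩ := hs k hk
      obtain ⟨l', hl', h'⟩ := ht (k ∘ l) (hk.comp hl)
      refine ⟨l ∘ l', hl.comp hl', ?_⟩
      have h2 := aux_sub h hl'
      rw [Metric.uniformCauchySeqOn_iff] at h' h2 ⊢
      intro ε hε
      obtain ⟨N, hN⟩ := h' ε hε
      obtain ⟨N', hN'⟩ := h2 ε hε
      refine ⟨max N N', fun i hi j hj x hx => ?_⟩
      rcases hx with hx | hx
      · exact hN' i ((le_max_right _ _).trans hi) j ((le_max_right _ _).trans hj) x hx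
      · exact hN i ((le_max_left _ _).trans hi) j ((le_max_left _ _).trans hj) x hx
    · intro x hx
      rw [mem_sphere] at hx
      obtain ⟨⟨U, hU, hxU, hfa⟩, R, hR⟩ := hF x (by rw [mem_ball]; linarith)
        (by rintro rfl; rw [dist_self] at hx; linarith)
      obtain ⟨σ, hσ, hσU⟩ := Metric.nhds_basis_closedBall.mem_iff.1 (hU.mem_nhds hxU)
      refine ⟨closedBall x σ, mem_nhdsWithin_of_mem_nhds (closedBall_mem_nhds x hσ), ?_⟩
      intro k hk
      obtain ⟨l, hl, hor⟩ := hfa k hk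
      refine ⟨l, hl, ?_⟩
      rcases hor with ⟨g, -, hg⟩ | hdiv
      · exact ((tendstoLocallyUniformlyOn_iff_forall_isCompact hU).1 hg _ hσU
          (isCompact_closedBall x σ)).uniformCauchySeqOn
      · exfalso
        obtain ⟨j, hj⟩ := (hdiv {x} (by simpa using hxU) isCompact_singleton (closedBall 0 R)
          (isCompact_closedBall _ _)).exists
        rw [Set.image_singleton, Set.disjoint_singleton_left] at hj
        exact hj (by rw [mem_closedBall_zero_iff]; exact hR _)
  obtain ⟨l, hl, h⟩ := hS k hk
  refine ⟨l, hl, Or.inl (aux_holo (fun j => iter_diff f _) ?_)⟩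
  rw [Metric.uniformCauchySeqOn_iff] at h ⊢
  intro ε hε
  obtain ⟨N, hN⟩ := h (ε / 2) (by positivity)
  refine ⟨N, fun i hi j hj x hx => ?_⟩
  have hne : ρ / 2 ≠ 0 := by positivity
  have := Complex.norm_le_of_forall_mem_frontier_norm_le (isBounded_ball (x := p) (r := ρ / 2))
    (((iter_diff f (k (l i))).sub (iter_diff f (k (l j)))).diffContOnCl) (C := ε / 2) (fun z hz => by
      rw [frontier_ball p hne] at hz
      have := hN i hi j hj z hz
      rw [dist_eq_norm] at this
      exact this.le) (subset_closure hx)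
  rw [dist_eq_norm]
  exact lt_of_le_of_lt this (by linarith)

theorem res_dich (O : Set (Endo n)) :
    {f : Endo n | O ∈ 𝓝 f ∨ ∃ V ∈ 𝓝 f, ∀ g ∈ V, O ∉ 𝓝 g} ∈ residual (Endo n) := by
  refine res_of_dense fun f V hV => ?_
  obtain ⟨W, hWV, hW, hfW⟩ := mem_nhds_iff.1 hV
  by_cases h : ∃ g ∈ W, O ∈ 𝓝 g
  · obtain ⟨g, hg, hO⟩ := h
    refine ⟨g, hWV hg, ?_⟩
    filter_upwards [eventually_mem_nhds_iff.2 hO] with x hx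
    exact Or.inl hx
  · push Not at h
    refine ⟨f, mem_of_mem_nhds hV, ?_⟩
    filter_upwards [hW.mem_nhds hfW] with x hx
    exact Or.inr ⟨W, hW.mem_nhds hx, h⟩

theorem res_perf (hn : 1 ≤ n) :
    {f : Endo n | ∀ p ∈ Julia f, p ∈ closure (Julia f \ {p})} ∈ residual (Endo n) := by
  have hc := TopologicalSpace.countable_countableBasis (Cn n)
  have hT := (eventually_countable_ball hc (l := residual (Endo n))
    (p := fun f U _ => {h : Endo n | (Julia h ∩ U).Nonempty} ∈ 𝓝 f ∨
      ∃ V ∈ 𝓝 f, ∀ g ∈ V, {h : Endo n | (Julia h ∩ U).Nonempty} ∉ 𝓝 g)).2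
    fun U _ => res_dich _
  filter_upwards [hT] with f hf p hp
  by_contra hcl
  rw [Metric.mem_closure_iff] at hcl
  push Not at hcl
  obtain ⟨ρ, hρ, hρp⟩ := hcl
  have hFa : ∀ x ∈ ball p ρ, x ≠ p → FatouAt f x := by
    intro x hx hxp
    by_contra hJ
    rw [mem_ball, dist_comm] at hx
    exact absurd (hρp x ⟨hJ, hxp⟩) (not_le.2 hx)
  refine hp (aux_perf hn hρ fun x hx hxp => ⟨hFa x hx hxp, ?_⟩)
  by_contra hunb
  have hop : IsOpen (ball p ρ \ {p}) := isOpen_ball.sdiff isClosed_singleton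
  obtain ⟨U, hUB, hxU, hUs⟩ := (TopologicalSpace.isBasis_countableBasis (Cn n)).exists_subset_of_mem_open
    (show x ∈ ball p ρ \ {p} from ⟨hx, hxp⟩) hop
  have hUo := TopologicalSpace.isOpen_of_mem_countableBasis hUB
  rcases hf U hUB with h | ⟨V, hV, h⟩
  · obtain ⟨z, hz, hzU⟩ := mem_of_mem_nhds h
    exact hz (hFa z (hUs hzU).1 (hUs hzU).2)
  · obtain ⟨g, hg, hO⟩ := aux_unb hunb hUo hxU hV
    exact h g hg hO

/-- For a generic endomorphism `f` of `ℂⁿ`: outside every compact set there are attracting,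
repelling (and, if `n ≥ 2`, saddle) fixed points; the Julia set is not compact; and the Julia
set is perfect (has no isolated points). -/
theorem stmt_13 (n : ℕ) (hn : 1 ≤ n) :
    {f : Endo n | (∀ K : Set (Cn n), IsCompact K →
        (∃ p ∉ K, IsAttFix f p) ∧ (∃ p ∉ K, IsRepFix f p) ∧
        (2 ≤ n → ∃ p ∉ K, IsSadFix f p)) ∧
      ¬ IsCompact (Julia f) ∧
      (∀ p ∈ Julia f, p ∈ closure (Julia f \ {p}))} ∈ residual (Endo n) := by
  have hs : {f : Endo n | 2 ≤ n → ∀ K : Set (Cn n), IsCompact K → ∃ p ∉ K, IsSadFix f p}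
      ∈ residual (Endo n) := by
    by_cases h2 : 2 ≤ n
    · filter_upwards [res_sad h2] with f hf _
      exact hf
    · exact Filter.univ_mem' fun f h => absurd h h2
  filter_upwards [res_att hn, res_rep hn, hs, res_perf hn] with f h1 h2 h3 h4
  refine ⟨fun K hK => ⟨h1 K hK, h2 K hK, fun h => h3 h K hK⟩, fun hJ => ?_, h4⟩
  obtain ⟨p, hp, hr⟩ := h2 _ hJ
  exact hp (rep_julia hn hr)
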